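/- Suppose λ := lim_{n→∞} λ(n)/n and ξ := lim_{n→∞} ξ(n)/n exist with ξ > λ, and let z ∈ [0,1] be such that (z,0) ∈ Λ. Then dim_H Λ_{λ,ξ}(z,0) = min{ γ/(1+λ), (γ + (ξ−λ)·log #J₂(0)/log b)/(1+ξ) }, where γ = log #J / log b. -/

import Mathlib

open Set Filter Topology MeasureTheory
open scoped ENNReal NNReal Topology

noncomputable section

namespace ShrinkingRect

/-- The real number with 1-indexed base-`b` digit sequence `u` (digit `i` is `u i` for `i ≥ 1`). -/
def val (b : ℕ) (u : ℕ → ℕ) : ℝ := ∑' i : ℕ, (u (i + 1) : ℝ) / (b : ℝ) ^ (i + 1)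

/-- The self-similar carpet `Λ` with digit set `J ⊆ {0,…,b−1}²`. -/
def carpet (b : ℕ) (J : Finset (ℕ × ℕ)) : Set (ℝ × ℝ) :=
  {p | ∃ d : ℕ → ℕ × ℕ, (∀ i, 1 ≤ i → d i ∈ J) ∧
    p = (val b (fun i => (d i).1), val b (fun i => (d i).2))}

/-- `J₂(a)`: the digits of `J` lying in row `a`. -/
def J2 (J : Finset (ℕ × ℕ)) (a : ℕ) : Finset (ℕ × ℕ) := J.filter fun p => p.2 = a

/-- The contraction `f_{u,v}(x,y) = ((x+u)/b, (y+v)/b)`. -/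
def fmap (b : ℕ) (uv : ℕ × ℕ) (p : ℝ × ℝ) : ℝ × ℝ :=
  ((p.1 + (uv.1 : ℝ)) / b, (p.2 + (uv.2 : ℝ)) / b)

/-- `f_t = f_{u₁,v₁} ∘ ⋯ ∘ f_{uₙ,vₙ}` for a finite word `t = ((u₁,v₁),…,(uₙ,vₙ))`. -/
def fword (b : ℕ) (t : List (ℕ × ℕ)) (p : ℝ × ℝ) : ℝ × ℝ :=
  t.foldr (fmap b) p

/-- The limsup set `W_{λ,ξ}(z,w)`. -/
def Wset (b : ℕ) (J : Finset (ℕ × ℕ)) (lam xi : ℕ → ℕ) (z w : ℝ) : Set (ℝ × ℝ) :=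
  {p | p ∈ carpet b J ∧
    {t : List (ℕ × ℕ) | t ≠ [] ∧ (∀ e ∈ t, e ∈ J) ∧
      |p.1 - (fword b t (z, w)).1| ≤ (b : ℝ) ^ (-(lam t.length : ℤ) - (t.length : ℤ)) ∧
      |p.2 - (fword b t (z, w)).2| ≤ (b : ℝ) ^ (-(xi t.length : ℤ) - (t.length : ℤ))}.Infinite}

/-- The closeness condition (in one coordinate) defining `M_n(z,w)`:
`xd` is the digit string of the point, `zd` that of the centre, `L` is `λ(n)` or `ξ(n)`. -/
def closeCond (b L n : ℕ) (zd xd : ℕ → ℕ) : Prop :=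
  (∀ i, 1 ≤ i → i < L → xd (i + n) = zd i) ∨
  (∃ j, 1 ≤ j ∧ j < L ∧ (∀ i, 1 ≤ i → i ≤ j - 1 → xd (i + n) = zd i) ∧
    (((xd (j + n) : ℤ) - (zd j : ℤ) = -1 ∧
        ∀ i, j + 1 ≤ i → i < L → (xd (i + n) : ℤ) - (zd i : ℤ) = (b : ℤ) - 1) ∨
     ((xd (j + n) : ℤ) - (zd j : ℤ) = 1 ∧
        ∀ i, j + 1 ≤ i → i < L → (zd i : ℤ) - (xd (i + n) : ℤ) = (b : ℤ) - 1)))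

/-- A choice of representative digit sequences for the points of the carpet: each point of `Λ`
gets a digit sequence in `J` representing it, whose partial products of row cardinalities
`∏ #J₂(y_i)` are eventually maximal among all representations of that point. -/
structure RepMap (b : ℕ) (J : Finset (ℕ × ℕ)) where
  rep : ℝ × ℝ → ℕ → ℕ × ℕ
  mem_J : ∀ p ∈ carpet b J, ∀ i, 1 ≤ i → rep p i ∈ J
  eq_val : ∀ p ∈ carpet b J,
    p = (val b (fun i => (rep p i).1), val b (fun i => (rep p i).2))
  maximal : ∀ p ∈ carpet b J, ∀ d : ℕ → ℕ × ℕ, (∀ i, 1 ≤ i → d i ∈ J) →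
    p = (val b (fun i => (d i).1), val b (fun i => (d i).2)) →
    ∃ N₀ : ℕ, ∀ N, N₀ ≤ N →
      ∏ i ∈ Finset.Icc 1 N, (J2 J (d i).2).card ≤
        ∏ i ∈ Finset.Icc 1 N, (J2 J (rep p i).2).card

/-- The expanding map `T(x,y) = (bx − x₁, by − y₁)`, where `(x_i,y_i)` is the representative
digit sequence of `(x,y)`. -/
def Tmap {b : ℕ} {J : Finset (ℕ × ℕ)} (R : RepMap b J) (p : ℝ × ℝ) : ℝ × ℝ :=
  ((b : ℝ) * p.1 - ((R.rep p 1).1 : ℝ), (b : ℝ) * p.2 - ((R.rep p 1).2 : ℝ))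

/-- The shrinking target set `Λ_{λ,ξ}(z,w)`. -/
def targetSet {b : ℕ} {J : Finset (ℕ × ℕ)} (R : RepMap b J) (lam xi : ℕ → ℕ)
    (z w : ℝ) : Set (ℝ × ℝ) :=
  {p | p ∈ carpet b J ∧ ∃ᶠ n in atTop,
    ((Tmap R)^[n] p).1 ∈ Icc (z - (b : ℝ) ^ (-(lam n : ℤ))) (z + (b : ℝ) ^ (-(lam n : ℤ))) ∧
    ((Tmap R)^[n] p).2 ∈ Icc (w - (b : ℝ) ^ (-(xi n : ℤ))) (w + (b : ℝ) ^ (-(xi n : ℤ)))}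

/-- The set `M_n(z,w)` (as a set of points of `Λ`, via representative sequences). -/
def Mset {b : ℕ} {J : Finset (ℕ × ℕ)} (R : RepMap b J) (lam xi : ℕ → ℕ)
    (zw : ℝ × ℝ) (n : ℕ) : Set (ℝ × ℝ) :=
  {p | p ∈ carpet b J ∧
    closeCond b (lam n) n (fun i => (R.rep zw i).1) (fun i => (R.rep p i).1) ∧
    closeCond b (xi n) n (fun i => (R.rep zw i).2) (fun i => (R.rep p i).2)}

/-- `p_{n,j}(a,y) = #{λ(n) ≤ i ≤ j : y_{i+n} = a}`. -/
def pcount {b : ℕ} {J : Finset (ℕ × ℕ)} (R : RepMap b J) (lam : ℕ → ℕ)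
    (p : ℝ × ℝ) (a n j : ℕ) : ℕ :=
  ((Finset.Icc (lam n) j).filter fun i => (R.rep p (i + n)).2 = a).card

/-- `A_{n,j}(z,w) = max_{(x,y) ∈ M_n(z,w)} Σ_a p_{n,j}(a,y) log #J₂(a)`. -/
def Aval {b : ℕ} {J : Finset (ℕ × ℕ)} (R : RepMap b J) (lam xi : ℕ → ℕ)
    (zw : ℝ × ℝ) (n j : ℕ) : ℝ :=
  sSup ((fun p => ∑ a ∈ Finset.range b,
    (pcount R lam p a n j : ℝ) * Real.log ((J2 J a).card)) '' Mset R lam xi zw n)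

/-- `s_n = min{ (n log #J + A_{n,j}(z,w)) / ((n+j) log b) : λ(n) ≤ j ≤ ξ(n) }`. -/
def sval {b : ℕ} {J : Finset (ℕ × ℕ)} (R : RepMap b J) (lam xi : ℕ → ℕ)
    (zw : ℝ × ℝ) (n : ℕ) : ℝ :=
  sInf ((fun j : ℕ => ((n : ℝ) * Real.log J.card + Aval R lam xi zw n j) /
    (((n : ℝ) + (j : ℝ)) * Real.log b)) '' Set.Icc (lam n) (xi n))

/-- `#{1 ≤ i ≤ n : u i = a}`. -/
def freqCount (u : ℕ → ℕ) (a n : ℕ) : ℕ := ((Finset.Icc 1 n).filter fun i => u i = a).card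

/-- The second-coordinate digit string of the representative sequence of a point. -/
def wdig {b : ℕ} {J : Finset (ℕ × ℕ)} (R : RepMap b J) (zw : ℝ × ℝ) (i : ℕ) : ℕ :=
  (R.rep zw i).2

/-- The integer formed by the first `m` digits of `u`. -/
def pre (b : ℕ) (u : ℕ → ℕ) : ℕ → ℕ
  | 0 => 0
  | m + 1 => b * pre b u m + u (m + 1)

section Digits

variable {b : ℕ} {u v : ℕ → ℕ}

lemma hasSum_max_digits (hb : 2 ≤ b) :
    HasSum (fun i : ℕ => ((b : ℝ) - 1) / (b : ℝ) ^ (i + 1)) 1 := by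
  have hb' : (2 : ℝ) ≤ b := by exact_mod_cast hb
  have h := (hasSum_geometric_of_lt_one (r := (b : ℝ)⁻¹) (by positivity)
    (inv_lt_one_of_one_lt₀ (by linarith))).mul_left (((b : ℝ) - 1) / b)
  have e : ((b : ℝ) - 1) / b * (1 - (b : ℝ)⁻¹)⁻¹ = 1 := by
    have : (b : ℝ) - 1 ≠ 0 := by linarith
    have h2 : 1 - (b : ℝ)⁻¹ = ((b : ℝ) - 1) / b := by field_simp
    rw [h2]; field_simp
  rw [e] at h
  refine h.congr_fun fun i => ?_
  rw [inv_pow, pow_succ]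
  field_simp

lemma digit_term_le (hu : ∀ i, 1 ≤ i → u i < b) (i : ℕ) :
    (u (i + 1) : ℝ) / (b : ℝ) ^ (i + 1) ≤ ((b : ℝ) - 1) / (b : ℝ) ^ (i + 1) := by
  have h : (u (i + 1) : ℝ) + 1 ≤ b := by exact_mod_cast hu (i + 1) (by omega)
  gcongr
  linarith

lemma summable_digits (hb : 2 ≤ b) (hu : ∀ i, 1 ≤ i → u i < b) :
    Summable (fun i : ℕ => (u (i + 1) : ℝ) / (b : ℝ) ^ (i + 1)) :=
  Summable.of_nonneg_of_le (fun i => by positivity) (digit_term_le hu)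
    (hasSum_max_digits hb).summable

lemma val_nonneg (b : ℕ) (u : ℕ → ℕ) : 0 ≤ val b u := tsum_nonneg fun i => by positivity

lemma val_le_one (hb : 2 ≤ b) (hu : ∀ i, 1 ≤ i → u i < b) : val b u ≤ 1 := by
  rw [← (hasSum_max_digits hb).tsum_eq]
  exact (summable_digits hb hu).tsum_le_tsum (digit_term_le hu) (hasSum_max_digits hb).summable

lemma digits_shift (hu : ∀ i, 1 ≤ i → u i < b) (n : ℕ) : ∀ i, 1 ≤ i → u (i + n) < b :=
  fun i hi => hu _ (by omega)

lemma val_step (hb : 2 ≤ b) (hu : ∀ i, 1 ≤ i → u i < b) :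
    (b : ℝ) * val b u = u 1 + val b (fun i => u (i + 1)) := by
  have hb0 : (b : ℝ) ≠ 0 := by positivity
  unfold val
  rw [(summable_digits hb hu).tsum_eq_zero_add, mul_add, ← tsum_mul_left]
  congr 1
  · field_simp; simp [mul_comm]
  · congr 1; ext i; field_simp; ring

lemma val_pre (hb : 2 ≤ b) (hu : ∀ i, 1 ≤ i → u i < b) (m : ℕ) :
    (b : ℝ) ^ m * val b u = pre b u m + val b (fun i => u (i + m)) := by
  induction m with
  | zero => simp [pre]
  | succ m ih =>
    have h := val_step hb (digits_shift hu m)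
    rw [pow_succ, mul_comm _ (b : ℝ), mul_assoc, ih, mul_add, h]
    have e : (fun i => u (i + 1 + m)) = fun i => u (i + (m + 1)) := by
      ext i; congr 1; omega
    rw [e, pre, add_comm 1 m]
    push_cast; ring

lemma pre_add (m k : ℕ) :
    pre b u (m + k) = b ^ k * pre b u m + pre b (fun i => u (i + m)) k := by
  induction k with
  | zero => simp [pre]
  | succ k ih =>
    rw [← add_assoc, pre, ih, pre, show k + 1 + m = m + k + 1 by omega]
    ring

lemma digits_eq_of_pre_eq (hu : ∀ i, 1 ≤ i → u i < b) (hv : ∀ i, 1 ≤ i → v i < b) {m : ℕ}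
    (h : pre b u m = pre b v m) : ∀ i, 1 ≤ i → i ≤ m → u i = v i := by
  induction m with
  | zero => intro i h1 h2; omega
  | succ m ih =>
    have hu' := hu (m + 1) (by omega)
    have hv' := hv (m + 1) (by omega)
    have hlast : u (m + 1) = v (m + 1) := by
      have := congrArg (· % b) h
      simpa [pre, Nat.mul_add_mod, Nat.mod_eq_of_lt hu', Nat.mod_eq_of_lt hv'] using this
    have hpre : pre b u m = pre b v m := by
      simp only [pre, hlast, add_left_inj] at h
      exact Nat.eq_of_mul_eq_mul_left (by omega) h
    intro i h1 h2
    rcases Nat.lt_or_ge m i with h3 | h3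
    · rw [show i = m + 1 by omega, hlast]
    · exact ih hpre i h1 h3

lemma pre_mem_Icc (hb : 2 ≤ b) (hu : ∀ i, 1 ≤ i → u i < b) {m : ℕ} {z : ℝ}
    (h : |val b u - z| ≤ ((b : ℝ) ^ m)⁻¹) :
    pre b u m ∈ Finset.Icc (⌊(b : ℝ) ^ m * z⌋₊ - 2) (⌊(b : ℝ) ^ m * z⌋₊ + 1) := by
  have hbm : (0 : ℝ) < (b : ℝ) ^ m := by positivity
  have h1 := val_pre hb hu m
  have h2 := val_nonneg b (fun i => u (i + m))
  have h3 := val_le_one hb (digits_shift hu m)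
  have h4 : |(b : ℝ) ^ m * val b u - (b : ℝ) ^ m * z| ≤ 1 := by
    rw [← mul_sub, abs_mul, abs_of_pos hbm]
    calc _ ≤ (b : ℝ) ^ m * ((b : ℝ) ^ m)⁻¹ := by gcongr
      _ = 1 := mul_inv_cancel₀ hbm.ne'
  rw [h1, abs_le] at h4
  have h6 := Nat.lt_floor_add_one ((b : ℝ) ^ m * z)
  rw [Finset.mem_Icc]
  constructor
  · rcases lt_or_ge z 0 with hz | hz
    · rw [Nat.floor_of_nonpos (mul_nonpos_of_nonneg_of_nonpos hbm.le hz.le)]; omega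
    have h5 := Nat.floor_le (show 0 ≤ (b : ℝ) ^ m * z by positivity)
    have : (⌊(b : ℝ) ^ m * z⌋₊ : ℝ) ≤ pre b u m + 2 := by linarith
    have : ⌊(b : ℝ) ^ m * z⌋₊ ≤ pre b u m + 2 := by exact_mod_cast this
    omega
  · have : (pre b u m : ℝ) < ⌊(b : ℝ) ^ m * z⌋₊ + 2 := by linarith
    have : pre b u m < ⌊(b : ℝ) ^ m * z⌋₊ + 2 := by exact_mod_cast this
    omega

lemma pre_eq_zero {m : ℕ} (h : ∀ i, 1 ≤ i → i ≤ m → u i = 0) : pre b u m = 0 := by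
  induction m with
  | zero => rfl
  | succ m ih =>
    rw [pre, ih fun i h1 h2 => h i h1 (by omega), h (m + 1) (by omega) le_rfl, mul_zero]

lemma eq_zero_of_val_lt (hb : 2 ≤ b) (hu : ∀ i, 1 ≤ i → u i < b) {m : ℕ}
    (h : (b : ℝ) ^ m * val b u < 1) : ∀ i, 1 ≤ i → i ≤ m → u i = 0 := by
  rw [val_pre hb hu m] at h
  have h2 := val_nonneg b (fun i => u (i + m))
  have h0 : pre b u m = 0 := by
    have : (pre b u m : ℝ) < 1 := by linarith
    have : pre b u m < 1 := by exact_mod_cast this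
    omega
  have h1 : pre b (fun _ => 0) m = 0 := pre_eq_zero fun _ _ _ => rfl
  exact digits_eq_of_pre_eq hu (fun _ _ => by omega) (h0.trans h1.symm)

lemma digits_eq_pred_of_val_eq_one (hb : 2 ≤ b) (hu : ∀ i, 1 ≤ i → u i < b)
    (h : val b u = 1) : ∀ n, u (n + 1) = b - 1 ∧ val b (fun i => u (i + n)) = 1 := by
  have key : ∀ w : ℕ → ℕ, (∀ i, 1 ≤ i → w i < b) → val b w = 1 →
      w 1 = b - 1 ∧ val b (fun i => w (i + 1)) = 1 := by
    intro w hw h1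
    have h2 := val_step hb hw
    have h3 := val_le_one hb (digits_shift hw 1)
    have h4 : (w 1 : ℝ) + 1 ≤ b := by exact_mod_cast hw 1 le_rfl
    rw [h1] at h2
    have h5 : (w 1 : ℝ) + 1 = b := by linarith
    have h6 : w 1 + 1 = b := by exact_mod_cast h5
    exact ⟨by omega, by linarith⟩
  have main : ∀ n, val b (fun i => u (i + n)) = 1 := by
    intro n
    induction n with
    | zero => simpa using h
    | succ n ih =>
      have := (key _ (digits_shift hu n) ih).2
      simpa [add_assoc, add_comm 1 n] using this
  intro n
  refine ⟨?_, main n⟩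
  have := (key _ (digits_shift hu n) (main n)).1
  simpa [add_comm 1 n] using this

lemma digits_eq_zero_of_val_eq_zero (hb : 2 ≤ b) (hu : ∀ i, 1 ≤ i → u i < b)
    (h : val b u = 0) : ∀ i, 1 ≤ i → u i = 0 :=
  fun i hi => eq_zero_of_val_lt hb hu (m := i) (by simp [h]) i hi le_rfl

/-- Two different base-`b` expansions of the same number are both eventually constant. -/
lemma eventually_const_of_val_eq (hb : 2 ≤ b) (hu : ∀ i, 1 ≤ i → u i < b)
    (hv : ∀ i, 1 ≤ i → v i < b) (h : val b u = val b v) :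
    (∀ i, 1 ≤ i → u i = v i) ∨ ∃ N c, ∀ i, N ≤ i → u i = c := by
  by_contra! hne
  obtain ⟨⟨i, hi, hiuv⟩, hnc⟩ := hne
  have main : ∀ n, val b (fun i => u (i + n)) = val b (fun i => v (i + n)) ∧
      ∀ i, 1 ≤ i → i ≤ n → u i = v i := by
    intro n
    induction n with
    | zero => exact ⟨by simpa using h, fun i h1 h2 => by omega⟩
    | succ n ih =>
      obtain ⟨ih1, ih2⟩ := ih
      have su := val_step hb (digits_shift hu n)
      have sv := val_step hb (digits_shift hv n)
      simp only [add_assoc, add_comm 1 n] at su sv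
      rw [ih1, sv] at su
      have hu0 := val_nonneg b (fun i => u (i + (n + 1)))
      have hu1 := val_le_one hb (digits_shift hu (n + 1))
      have hv0 := val_nonneg b (fun i => v (i + (n + 1)))
      have hv1 := val_le_one hb (digits_shift hv (n + 1))
      have hd : u (n + 1) = v (n + 1) := by
        rcases lt_trichotomy (u (n + 1)) (v (n + 1)) with hlt | heq | hlt
        · exfalso
          have : (u (n + 1) : ℝ) + 1 ≤ v (n + 1) := by exact_mod_cast hlt
          have hval : val b (fun i => u (i + (n + 1))) = 1 := by linarith
          obtain ⟨j, hj, hj'⟩ := hnc (n + 2) (b - 1)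
          have := (digits_eq_pred_of_val_eq_one hb (digits_shift hu (n + 1)) hval (j - n - 2)).1
          exact hj' (by rwa [show j - n - 2 + 1 + (n + 1) = j by omega] at this)
        · exact heq
        · exfalso
          have : (v (n + 1) : ℝ) + 1 ≤ u (n + 1) := by exact_mod_cast hlt
          have hval : val b (fun i => u (i + (n + 1))) = 0 := by linarith
          obtain ⟨j, hj, hj'⟩ := hnc (n + 2) 0
          have := digits_eq_zero_of_val_eq_zero hb (digits_shift hu (n + 1)) hval (j - n - 1)
            (by omega)
          exact hj' (by rwa [show j - n - 1 + (n + 1) = j by omega] at this)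
      refine ⟨by rw [hd] at su; linarith, fun i h1 h2 => ?_⟩
      rcases Nat.lt_or_ge n i with h3 | h3
      · rw [show i = n + 1 by omega, hd]
      · exact ih2 i h1 h3
  exact hiuv ((main i).2 i hi le_rfl)

end Digits

section Coding

variable {b : ℕ} {J : Finset (ℕ × ℕ)}

/-- The point of the plane coded by the digit sequence `d`. -/
def point (b : ℕ) (d : ℕ → ℕ × ℕ) : ℝ × ℝ := (val b fun i => (d i).1, val b fun i => (d i).2)

lemma fst_lt (hJ : J ⊆ Finset.range b ×ˢ Finset.range b) {d : ℕ → ℕ × ℕ}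
    (hd : ∀ i, 1 ≤ i → d i ∈ J) : ∀ i, 1 ≤ i → (d i).1 < b := fun i hi => by
  simpa using (Finset.mem_product.mp (hJ (hd i hi))).1

lemma snd_lt (hJ : J ⊆ Finset.range b ×ˢ Finset.range b) {d : ℕ → ℕ × ℕ}
    (hd : ∀ i, 1 ≤ i → d i ∈ J) : ∀ i, 1 ≤ i → (d i).2 < b := fun i hi => by
  simpa using (Finset.mem_product.mp (hJ (hd i hi))).2

lemma coord_eq_of_frequently (hb : 2 ≤ b) {f : ℕ × ℕ → ℕ} {d e : ℕ → ℕ × ℕ}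
    (hd : ∀ i, 1 ≤ i → d i ∈ J) (he : ∀ i, 1 ≤ i → e i ∈ J)
    (hdb : ∀ i, 1 ≤ i → f (d i) < b) (heb : ∀ i, 1 ≤ i → f (e i) < b)
    (hfr : ∀ a ∈ J, ∃ᶠ i in atTop, d i = a)
    (h : val b (fun i => f (d i)) = val b (fun i => f (e i))) :
    ∀ i, 1 ≤ i → f (d i) = f (e i) := by
  rcases eventually_const_of_val_eq hb hdb heb h with h1 | ⟨N, c, hc⟩
  · exact h1
  · have hcJ : ∀ a ∈ J, f a = c := by
      intro a ha
      obtain ⟨i, hi, hia⟩ := (frequently_atTop.mp (hfr a ha)) N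
      rw [← hia]; exact hc i hi
    intro i hi
    rw [hcJ _ (hd i hi), hcJ _ (he i hi)]

/-- A digit sequence in `J` containing every digit of `J` infinitely often is the only
digit sequence in `J` coding its point. -/
lemma coding_unique (hb : 2 ≤ b) (hJ : J ⊆ Finset.range b ×ˢ Finset.range b)
    {d e : ℕ → ℕ × ℕ} (hd : ∀ i, 1 ≤ i → d i ∈ J) (he : ∀ i, 1 ≤ i → e i ∈ J)
    (hfr : ∀ a ∈ J, ∃ᶠ i in atTop, d i = a) (h : point b d = point b e) :
    ∀ i, 1 ≤ i → d i = e i := by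
  have h1 := coord_eq_of_frequently (f := Prod.fst) hb hd he (fst_lt hJ hd) (fst_lt hJ he) hfr
    (congrArg Prod.fst h)
  have h2 := coord_eq_of_frequently (f := Prod.snd) hb hd he (snd_lt hJ hd) (snd_lt hJ he) hfr
    (congrArg Prod.snd h)
  exact fun i hi => Prod.ext (h1 i hi) (h2 i hi)

lemma shift_mem {d : ℕ → ℕ × ℕ} (hd : ∀ i, 1 ≤ i → d i ∈ J) (n : ℕ) :
    ∀ i, 1 ≤ i → d (i + n) ∈ J := fun i hi => hd _ (by omega)

lemma Tmap_eq_point_shift (hb : 2 ≤ b) (hJ : J ⊆ Finset.range b ×ˢ Finset.range b)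
    (R : RepMap b J) {p : ℝ × ℝ} {d : ℕ → ℕ × ℕ} (hd : ∀ i, 1 ≤ i → d i ∈ J)
    (hp : p = point b d) (h1 : R.rep p 1 = d 1) :
    Tmap R p = point b (fun i => d (i + 1)) := by
  have hx := val_step hb (fst_lt hJ hd)
  have hy := val_step hb (snd_lt hJ hd)
  rw [Tmap, h1, hp]
  simp only [point]
  rw [hx, hy]
  simp

lemma Tmap_mem_carpet (hb : 2 ≤ b) (hJ : J ⊆ Finset.range b ×ˢ Finset.range b)
    (R : RepMap b J) {p : ℝ × ℝ} (hp : p ∈ carpet b J) : Tmap R p ∈ carpet b J :=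
  ⟨_, shift_mem (R.mem_J p hp) 1, Tmap_eq_point_shift hb hJ R (R.mem_J p hp) (R.eq_val p hp) rfl⟩

/-- Following the orbit of `p` under `T` produces a digit sequence of `p` whose `n`-th shift
codes `Tⁿ p`. -/
lemma exists_coding_iterate (hb : 2 ≤ b) (hJ : J ⊆ Finset.range b ×ˢ Finset.range b)
    (R : RepMap b J) (n : ℕ) {p : ℝ × ℝ} (hp : p ∈ carpet b J) :
    ∃ d : ℕ → ℕ × ℕ, (∀ i, 1 ≤ i → d i ∈ J) ∧ p = point b d ∧
      (Tmap R)^[n] p = point b (fun i => d (i + n)) := by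
  induction n generalizing p with
  | zero => exact ⟨R.rep p, R.mem_J p hp, R.eq_val p hp, R.eq_val p hp⟩
  | succ n ih =>
    obtain ⟨d, hd, hpd, hn⟩ := ih (Tmap_mem_carpet hb hJ R hp)
    let e : ℕ → ℕ × ℕ := fun i => if i ≤ 1 then R.rep p 1 else d (i - 1)
    have he : ∀ i, 1 ≤ i → e (i + 1) = d i := fun i hi => by
      simp [e, show i ≠ 0 by omega]
    have heJ : ∀ i, 1 ≤ i → e i ∈ J := by
      intro i hi
      by_cases h : i ≤ 1
      · simpa [e, h] using R.mem_J p hp 1 le_rfl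
      · simpa [e, h] using hd (i - 1) (by omega)
    have hshift : point b (fun i => e (i + 1)) = point b d := by
      simp only [point, val, he _ (Nat.le_add_left 1 _)]
    refine ⟨e, heJ, ?_, ?_⟩
    · have hb0 : (b : ℝ) ≠ 0 := by positivity
      have e1 : e 1 = R.rep p 1 := by simp [e]
      have hx := val_step hb (fst_lt hJ heJ)
      have hy := val_step hb (snd_lt hJ heJ)
      have h1 := congrArg Prod.fst (hpd.trans hshift.symm)
      have h2 := congrArg Prod.snd (hpd.trans hshift.symm)
      simp only [Tmap, point] at h1 h2
      rw [e1] at hx hy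
      refine Prod.ext (mul_left_cancel₀ hb0 ?_) (mul_left_cancel₀ hb0 ?_)
      · simp only [point]; linarith
      · simp only [point]; linarith
    · rw [Function.iterate_succ_apply, hn]
      have : ∀ i, e (i + 1 + (n + 1)) = d (i + 1 + n) := fun i => by
        rw [← he _ (by omega)]; congr 1
      simp only [point, val, this]

lemma iterate_Tmap_of_frequently (hb : 2 ≤ b) (hJ : J ⊆ Finset.range b ×ˢ Finset.range b)
    (R : RepMap b J) {d : ℕ → ℕ × ℕ} (hd : ∀ i, 1 ≤ i → d i ∈ J)
    (hfr : ∀ a ∈ J, ∃ᶠ i in atTop, d i = a) (n : ℕ) :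
    (Tmap R)^[n] (point b d) = point b (fun i => d (i + n)) := by
  induction n with
  | zero => rfl
  | succ n ih =>
    rw [Function.iterate_succ_apply', ih]
    have hc : point b (fun i => d (i + n)) ∈ carpet b J := ⟨_, shift_mem hd n, rfl⟩
    have hfr' : ∀ a ∈ J, ∃ᶠ i in atTop, d (i + n) = a := by
      intro a ha
      rw [frequently_atTop]
      intro N
      obtain ⟨i, hi, hia⟩ := frequently_atTop.mp (hfr a ha) (N + n)
      exact ⟨i - n, by omega, by rwa [show i - n + n = i by omega]⟩
    have hrep := coding_unique hb hJ (shift_mem hd n) (R.mem_J _ hc) hfr' (R.eq_val _ hc)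
    rw [Tmap_eq_point_shift hb hJ R (shift_mem hd n) rfl (hrep 1 le_rfl).symm]
    simp only [add_assoc, add_comm 1 n]

/-- If the digits of `d` following position `n` agree with those of a coding of `(z, 0)` on a block
of length `lam n`, and stay in row `0` up to length `xi n`, then the `n`-th iterate of the
corresponding point lies in the `n`-th target. -/
lemma point_mem_target (hb : 2 ≤ b) (hJ : J ⊆ Finset.range b ×ˢ Finset.range b)
    {d c : ℕ → ℕ × ℕ} (hd : ∀ i, 1 ≤ i → d i ∈ J) (hc : ∀ i, 1 ≤ i → c i ∈ J) {L M : ℕ}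
    (h1 : ∀ i, 1 ≤ i → i ≤ L → d i = c i) (h2 : ∀ i, 1 ≤ i → i ≤ M → (d i).2 = 0) :
    (point b d).1 ∈ Icc ((point b c).1 - (b : ℝ) ^ (-(L : ℤ))) ((point b c).1 + (b : ℝ) ^ (-(L : ℤ)))
    ∧ (point b d).2 ∈ Icc (0 - (b : ℝ) ^ (-(M : ℤ))) (0 + (b : ℝ) ^ (-(M : ℤ))) := by
  have key : ∀ (u v : ℕ → ℕ) (K : ℕ), (∀ i, 1 ≤ i → u i < b) → (∀ i, 1 ≤ i → v i < b) →
      (∀ i, 1 ≤ i → i ≤ K → u i = v i) →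
      val b u ∈ Icc (val b v - (b : ℝ) ^ (-(K : ℤ))) (val b v + (b : ℝ) ^ (-(K : ℤ))) := by
    intro u v K hu hv huv
    have hbK : (0 : ℝ) < (b : ℝ) ^ K := by positivity
    have hpre : pre b u K = pre b v K := by
      clear hu hv hbK
      induction K with
      | zero => rfl
      | succ K ih => rw [pre, pre, ih fun i h1 h2 => huv i h1 (by omega), huv _ (by omega) le_rfl]
    have hu1 := val_pre hb hu K
    have hv1 := val_pre hb hv K
    rw [hpre] at hu1
    have a1 := val_nonneg b (fun i => u (i + K))
    have a2 := val_nonneg b (fun i => v (i + K))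
    have a3 := val_le_one hb (digits_shift hu K)
    have a4 := val_le_one hb (digits_shift hv K)
    rw [zpow_neg, zpow_natCast, mem_Icc]
    constructor
    · refine le_of_mul_le_mul_left ?_ hbK
      rw [mul_sub, mul_inv_cancel₀ hbK.ne']; linarith
    · refine le_of_mul_le_mul_left ?_ hbK
      rw [mul_add, mul_inv_cancel₀ hbK.ne']; linarith
  refine ⟨key _ _ L (fst_lt hJ hd) (fst_lt hJ hc) fun i hi hi' => by rw [h1 i hi hi'], ?_⟩
  have h0 : val b (fun _ => 0) = 0 := by simp [val]
  have := key (fun i => (d i).2) (fun _ => 0) M (snd_lt hJ hd) (fun _ _ => by omega) h2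
  rwa [h0] at this

end Coding

section UpperBound

lemma dimH_le_of_frequently_mem {X ι : Type*} [MetricSpace X] [MeasurableSpace X] [BorelSpace X]
    {E : Set X} {s : ℝ≥0} (hs : 0 < s) (I : ℕ → Finset ι) (t : ℕ → ι → Set X) (r : ℕ → ℝ)
    (hr0 : ∀ n, 0 ≤ r n) (hr : ∀ n, r n ≤ (2⁻¹ : ℝ) ^ n)
    (ht : ∀ n, ∀ i ∈ I n, Metric.ediam (t n i) ≤ ENNReal.ofReal (r n))
    (hsum : Summable fun n => ((I n).card : ℝ) * r n ^ (s : ℝ))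
    (hE : ∀ p ∈ E, ∃ᶠ n in atTop, ∃ i ∈ I n, p ∈ t n i) : dimH E ≤ s := by
  have hs' : (0 : ℝ) < s := by exact_mod_cast hs
  have hs0 : (0 : ℝ) ≤ s := hs'.le
  have hnonneg : ∀ n, 0 ≤ ((I n).card : ℝ) * r n ^ (s : ℝ) := fun n => by
    have := hr0 n; positivity
  refine dimH_le_of_hausdorffMeasure_ne_top ?_
  have htend : Tendsto (fun N => ∑' n, ENNReal.ofReal (((I (n + N)).card : ℝ) * r (n + N) ^ (s : ℝ)))
      atTop (𝓝 0) :=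
    ENNReal.tendsto_sum_nat_add (fun n => ENNReal.ofReal (((I n).card : ℝ) * r n ^ (s : ℝ)))
      (by rw [← ENNReal.ofReal_tsum_of_nonneg hnonneg hsum]; exact ENNReal.ofReal_ne_top)
  have hpow : Tendsto (fun N : ℕ => ENNReal.ofReal ((2⁻¹ : ℝ) ^ N)) atTop (𝓝 0) := by
    rw [← ENNReal.ofReal_zero]
    exact (ENNReal.continuous_ofReal.tendsto 0).comp
      (tendsto_pow_atTop_nhds_zero_of_lt_one (by norm_num) (by norm_num))
  have hle := Measure.hausdorffMeasure_le_liminf_tsum (l := atTop)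
    (ι := fun N : ℕ => Σ n : ℕ, {i // i ∈ I (n + N)}) (s : ℝ) E
    (fun N => ENNReal.ofReal ((2⁻¹ : ℝ) ^ N)) hpow (fun N i => t (i.1 + N) i.2.1)
    (Eventually.of_forall fun N i => (ht _ _ i.2.2).trans (ENNReal.ofReal_le_ofReal
      ((hr _).trans (pow_le_pow_of_le_one (by norm_num) (by norm_num) (by omega)))))
    (Eventually.of_forall fun N p hp => by
      obtain ⟨n, hn, i, hi, hpi⟩ := frequently_atTop.mp (hE p hp) N
      obtain ⟨k, rfl⟩ := Nat.exists_eq_add_of_le' hn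
      exact mem_iUnion.mpr ⟨⟨k, i, hi⟩, hpi⟩)
  have hbound : ∀ N : ℕ, (∑' i : Σ n : ℕ, {i // i ∈ I (n + N)},
      Metric.ediam (t (i.1 + N) i.2.1) ^ (s : ℝ)) ≤
      ∑' n, ENNReal.ofReal (((I (n + N)).card : ℝ) * r (n + N) ^ (s : ℝ)) := by
    intro N
    rw [ENNReal.tsum_sigma']
    refine ENNReal.tsum_le_tsum fun n => ?_
    rw [tsum_fintype]
    calc _ ≤ ∑ _i : {i // i ∈ I (n + N)}, ENNReal.ofReal (r (n + N)) ^ (s : ℝ) :=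
          Finset.sum_le_sum fun i _ => ENNReal.rpow_le_rpow (ht _ _ i.2) hs0
      _ = _ := by
          rw [Finset.sum_const, Finset.card_univ, Fintype.card_coe, nsmul_eq_mul,
            ENNReal.ofReal_mul (by positivity), ENNReal.ofReal_natCast,
            ENNReal.ofReal_rpow_of_nonneg (hr0 _) hs0]
  have hlim := (liminf_le_liminf (Eventually.of_forall hbound)).trans htend.liminf_eq.le
  exact ((hle.trans hlim).trans_lt ENNReal.zero_lt_top).ne

/-- The pairs of integers formed by the words of length `n` over the alphabet `A`. -/
def prefixes (b : ℕ) (A : Finset (ℕ × ℕ)) : ℕ → Finset (ℕ × ℕ)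
  | 0 => {(0, 0)}
  | n + 1 => (prefixes b A n ×ˢ A).image fun q => (b * q.1.1 + q.2.1, b * q.1.2 + q.2.2)

lemma card_prefixes_le (b : ℕ) (A : Finset (ℕ × ℕ)) (n : ℕ) :
    (prefixes b A n).card ≤ A.card ^ n := by
  induction n with
  | zero => simp [prefixes]
  | succ n ih =>
    refine Finset.card_image_le.trans ?_
    rw [Finset.card_product, pow_succ]
    exact Nat.mul_le_mul_right _ ih

lemma pre_mem_prefixes {b : ℕ} {A : Finset (ℕ × ℕ)} {d : ℕ → ℕ × ℕ} {n : ℕ}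
    (h : ∀ i, 1 ≤ i → i ≤ n → d i ∈ A) :
    (pre b (fun i => (d i).1) n, pre b (fun i => (d i).2) n) ∈ prefixes b A n := by
  induction n with
  | zero => simp [prefixes, pre]
  | succ n ih =>
    exact Finset.mem_image.mpr ⟨(_, d (n + 1)), Finset.mem_product.mpr
      ⟨ih fun i h1 h2 => h i h1 (by omega), h _ (by omega) le_rfl⟩, rfl⟩

/-- The closed `b`-adic square of level `m` with integer coordinates `q`. -/
def square (b m : ℕ) (q : ℕ × ℕ) : Set (ℝ × ℝ) :=
  {p | (b : ℝ) ^ m * p.1 ∈ Icc (q.1 : ℝ) (q.1 + 1) ∧ (b : ℝ) ^ m * p.2 ∈ Icc (q.2 : ℝ) (q.2 + 1)}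

lemma ediam_square_le {b : ℕ} (hb : 2 ≤ b) (m : ℕ) (q : ℕ × ℕ) :
    Metric.ediam (square b m q) ≤ ENNReal.ofReal (((b : ℝ) ^ m)⁻¹) := by
  have hbm : (0 : ℝ) < (b : ℝ) ^ m := by positivity
  have key : ∀ (k : ℕ) (a a' : ℝ), (b : ℝ) ^ m * a ∈ Icc (k : ℝ) (k + 1) →
      (b : ℝ) ^ m * a' ∈ Icc (k : ℝ) (k + 1) → dist a a' ≤ ((b : ℝ) ^ m)⁻¹ := by
    intro k a a' h h'
    rw [Real.dist_eq]
    refine le_of_mul_le_mul_left ?_ hbm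
    have habs : (b : ℝ) ^ m * |a - a'| = |(b : ℝ) ^ m * (a - a')| := by
      rw [abs_mul, abs_of_pos hbm]
    rw [mul_inv_cancel₀ hbm.ne', habs, mul_sub, abs_le]
    constructor <;> linarith [h.1, h.2, h'.1, h'.2]
  refine Metric.ediam_le fun p hp p' hp' => ?_
  rw [edist_dist]
  exact ENNReal.ofReal_le_ofReal (max_le (key _ _ _ hp.1 hp'.1) (key _ _ _ hp.2 hp'.2))

lemma point_mem_square {b : ℕ} {J : Finset (ℕ × ℕ)} (hb : 2 ≤ b)
    (hJ : J ⊆ Finset.range b ×ˢ Finset.range b) {d : ℕ → ℕ × ℕ} (hd : ∀ i, 1 ≤ i → d i ∈ J)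
    (m : ℕ) :
    point b d ∈ square b m (pre b (fun i => (d i).1) m, pre b (fun i => (d i).2) m) := by
  have key : ∀ u : ℕ → ℕ, (∀ i, 1 ≤ i → u i < b) →
      (b : ℝ) ^ m * val b u ∈ Icc (pre b u m : ℝ) (pre b u m + 1) := by
    intro u hu
    rw [val_pre hb hu m]
    exact ⟨by linarith [val_nonneg b fun i => u (i + m)],
      by linarith [val_le_one hb (digits_shift hu m)]⟩
  exact ⟨key _ (fst_lt hJ hd), key _ (snd_lt hJ hd)⟩

/-- Integer coordinates of the `b`-adic squares of level `n + (M - 1)` needed to cover the points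
whose `n`-th iterate lies in the target of size `b ^ (-L) × b ^ (-M)` around `(z, 0)`. -/
def coverIndex (b : ℕ) (J : Finset (ℕ × ℕ)) (z : ℝ) (n L M : ℕ) : Finset (ℕ × ℕ) :=
  (prefixes b J n ×ˢ (Finset.Icc (⌊(b : ℝ) ^ (L - 1) * z⌋₊ - 2) (⌊(b : ℝ) ^ (L - 1) * z⌋₊ + 1) ×ˢ
    prefixes b (J2 J 0) (M - L))).image fun q =>
      (b ^ (M - 1) * q.1.1 + (b ^ (M - L) * q.2.1 + q.2.2.1), b ^ (M - 1) * q.1.2 + q.2.2.2)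

lemma card_coverIndex_le (b : ℕ) (J : Finset (ℕ × ℕ)) (z : ℝ) (n L M : ℕ) :
    (coverIndex b J z n L M).card ≤ 4 * (J.card ^ n * (J2 J 0).card ^ (M - L)) := by
  refine Finset.card_image_le.trans ?_
  rw [Finset.card_product, Finset.card_product]
  have h1 := card_prefixes_le b J n
  have h2 := card_prefixes_le b (J2 J 0) (M - L)
  have h3 : (Finset.Icc (⌊(b : ℝ) ^ (L - 1) * z⌋₊ - 2) (⌊(b : ℝ) ^ (L - 1) * z⌋₊ + 1)).card ≤ 4 := by
    rw [Nat.card_Icc]; omega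
  calc _ ≤ J.card ^ n * (4 * (J2 J 0).card ^ (M - L)) := by gcongr
    _ = _ := by ring

lemma mem_cover {b : ℕ} {J : Finset (ℕ × ℕ)} (hb : 2 ≤ b)
    (hJ : J ⊆ Finset.range b ×ˢ Finset.range b) {z : ℝ} {n L M : ℕ} (hL : 1 ≤ L)
    (hLM : L ≤ M) {d : ℕ → ℕ × ℕ} (hd : ∀ i, 1 ≤ i → d i ∈ J)
    (h1 : (point b fun i => d (i + n)).1 ∈ Icc (z - (b : ℝ) ^ (-(L : ℤ))) (z + (b : ℝ) ^ (-(L : ℤ))))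
    (h2 : (point b fun i => d (i + n)).2 ∈ Icc (0 - (b : ℝ) ^ (-(M : ℤ))) (0 + (b : ℝ) ^ (-(M : ℤ)))) :
    ∃ q ∈ coverIndex b J z n L M, point b d ∈ square b (n + (M - 1)) q := by
  have hb1 : (1 : ℝ) < b := by exact_mod_cast hb
  have hb0 : (0 : ℝ) < b := by linarith
  have hmono : ∀ K : ℕ, 1 ≤ K → (b : ℝ) ^ (-(K : ℤ)) < ((b : ℝ) ^ (K - 1))⁻¹ := by
    intro K hK
    rw [zpow_neg, zpow_natCast]
    exact inv_strictAnti₀ (by positivity) (pow_lt_pow_right₀ hb1 (by omega))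
  have hsd := shift_mem hd n
  have hrow : ∀ i, 1 ≤ i → i ≤ M - 1 → (d (i + n)).2 = 0 := by
    refine eq_zero_of_val_lt hb (snd_lt hJ hsd) ?_
    have h3 : val b (fun i => (d (i + n)).2) < ((b : ℝ) ^ (M - 1))⁻¹ := by
      have := h2.2
      simp only [point, zero_add] at this
      exact this.trans_lt (hmono M (by omega))
    calc _ < (b : ℝ) ^ (M - 1) * ((b : ℝ) ^ (M - 1))⁻¹ := by gcongr
      _ = 1 := mul_inv_cancel₀ (by positivity)
  have hcol := pre_mem_Icc (m := L - 1) (z := z) hb (fst_lt hJ hsd) (by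
    have hlt := hmono L hL
    have ha := h1.1
    have hc := h1.2
    simp only [point] at ha hc
    rw [abs_le]; constructor <;> linarith)
  refine ⟨_, ?_, point_mem_square hb hJ hd (n + (M - 1))⟩
  have hJ2 := pre_mem_prefixes (b := b) (A := J2 J 0) (d := fun i => d (i + (L - 1) + n))
    (n := M - L) fun i hi hi' => Finset.mem_filter.mpr
      ⟨hd _ (by omega), hrow (i + (L - 1)) (by omega) (by omega)⟩
  have hJn := pre_mem_prefixes (b := b) (n := n) fun i hi _ => hd i hi
  refine Finset.mem_image.mpr ⟨(_, _, _), Finset.mem_product.mpr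
    ⟨hJn, Finset.mem_product.mpr ⟨hcol, hJ2⟩⟩, ?_⟩
  have hsplit : M - 1 = L - 1 + (M - L) := by omega
  refine Prod.ext ?_ ?_
  · simp only
    rw [pre_add n (M - 1), add_right_inj]
    conv_rhs => rw [hsplit, pre_add]
  · simp only
    rw [pre_add n (M - 1), add_right_inj, pre_eq_zero hrow]
    exact pre_eq_zero fun i hi hi' => hrow (i + (L - 1)) (by omega) (by omega)

lemma summable_exp_of_tendsto {E : ℕ → ℝ} {e : ℝ} (he : e < 0)
    (hE : Tendsto (fun n => E n / n) atTop (𝓝 e)) : Summable fun n => Real.exp (E n) := by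
  have hs : Summable fun n : ℕ => Real.exp (n * (e / 2)) :=
    Real.summable_exp_nat_mul_iff.mpr (by linarith)
  refine Summable.of_norm_bounded_eventually_nat hs ?_
  filter_upwards [hE.eventually_lt_const (show e < e / 2 by linarith), eventually_gt_atTop 0]
    with n hn hn0
  rw [Real.norm_of_nonneg (Real.exp_pos _).le, Real.exp_le_exp]
  have : (0 : ℝ) < n := by exact_mod_cast hn0
  rw [div_lt_iff₀ this] at hn
  linarith

lemma dimH_targetSet_le {b : ℕ} {J : Finset (ℕ × ℕ)} (hb : 2 ≤ b)
    (hJ : J ⊆ Finset.range b ×ˢ Finset.range b) (hJ0 : 0 < J.card) (hJ2 : 0 < (J2 J 0).card)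
    (R : RepMap b J) {lam xi : ℕ → ℕ} (hlam_pos : ∀ n, 1 ≤ lam n) (hle : ∀ n, lam n ≤ xi n)
    {l x : ℝ} (hl : Tendsto (fun n : ℕ => (lam n : ℝ) / n) atTop (𝓝 l))
    (hx : Tendsto (fun n : ℕ => (xi n : ℝ) / n) atTop (𝓝 x)) (z : ℝ) :
    dimH (targetSet R lam xi z 0) ≤ ENNReal.ofReal
      ((Real.log J.card / Real.log b + (x - l) * (Real.log (J2 J 0).card / Real.log b)) / (1 + x)) := by
  have hb1 : (1 : ℝ) < b := by exact_mod_cast hb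
  have hb0 : (0 : ℝ) < b := by linarith
  have hlb : 0 < Real.log b := Real.log_pos hb1
  have hx0 : 0 ≤ x := ge_of_tendsto' hx fun n => by positivity
  by_contra! hlt
  obtain ⟨s, hs1, hs2⟩ := ENNReal.lt_iff_exists_nnreal_btwn.mp hlt
  refine hs2.not_ge ?_
  have hs0 : 0 < s := by
    have : (0 : ℝ≥0∞) < s := zero_le.trans_lt hs1
    exact_mod_cast this
  have hsv : (Real.log J.card / Real.log b + (x - l) * (Real.log (J2 J 0).card / Real.log b)) /
      (1 + x) < s := by
    by_contra! hge
    have := ENNReal.ofReal_le_ofReal hge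
    rw [ENNReal.ofReal_coe_nnreal] at this
    exact hs1.not_ge this
  have hneg : Real.log J.card + (x - l) * Real.log (J2 J 0).card - s * Real.log b * (1 + x) < 0 := by
    rw [div_lt_iff₀ (by linarith)] at hsv
    have := mul_lt_mul_of_pos_right hsv hlb
    rw [add_mul, mul_assoc (x - l), div_mul_cancel₀ _ hlb.ne', div_mul_cancel₀ _ hlb.ne'] at this
    linarith
  let E : ℕ → ℝ := fun n => n * Real.log J.card + ((xi n : ℝ) - lam n) * Real.log (J2 J 0).card -
    s * Real.log b * (n + (xi n - 1))
  have hE : Tendsto (fun n => E n / n) atTop (𝓝 (Real.log J.card +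
      (x - l) * Real.log (J2 J 0).card - s * Real.log b * (1 + (x - 0)))) := by
    have h1 := ((hx.sub hl).mul_const (Real.log (J2 J 0).card)).const_add (Real.log J.card)
    have h2 := ((hx.sub tendsto_one_div_atTop_nhds_zero_nat).const_add 1).const_mul
      (s * Real.log b)
    refine (h1.sub h2).congr' ?_
    filter_upwards [eventually_gt_atTop 0] with n hn
    have : (n : ℝ) ≠ 0 := by positivity
    simp only [E]
    field_simp
  have hsum := (summable_exp_of_tendsto (by rwa [sub_zero]) hE).mul_left 4
  refine dimH_le_of_frequently_mem hs0 (fun n => coverIndex b J z n (lam n) (xi n))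
    (fun n => square b (n + (xi n - 1))) (fun n => ((b : ℝ) ^ (n + (xi n - 1)))⁻¹)
    (fun n => by positivity) (fun n => ?_) (fun n i _ => ediam_square_le hb _ i)
    (Summable.of_nonneg_of_le (fun n => by positivity) (fun n => ?_) hsum) ?_
  · rw [inv_pow]
    refine inv_anti₀ (by positivity) ?_
    calc (2 : ℝ) ^ n ≤ (b : ℝ) ^ n := by gcongr; exact_mod_cast hb
      _ ≤ _ := pow_le_pow_right₀ hb1.le (by omega)
  · have hcard : ((coverIndex b J z n (lam n) (xi n)).card : ℝ) ≤
        4 * ((J.card : ℝ) ^ n * ((J2 J 0).card : ℝ) ^ (xi n - lam n)) := by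
      exact_mod_cast card_coverIndex_le b J z n (lam n) (xi n)
    have hexp : Real.exp (E n) = (J.card : ℝ) ^ n * ((J2 J 0).card : ℝ) ^ (xi n - lam n) *
        (((b : ℝ) ^ (n + (xi n - 1)))⁻¹) ^ (s : ℝ) := by
      have e1 : ∀ (a : ℝ) (k : ℕ), 0 < a → a ^ k = Real.exp (k * Real.log a) := fun a k ha => by
        rw [mul_comm, ← Real.rpow_def_of_pos ha, Real.rpow_natCast]
      rw [e1 _ _ (by exact_mod_cast hJ0), e1 _ _ (by exact_mod_cast hJ2), e1 _ _ hb0,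
        ← Real.exp_neg, ← Real.exp_mul, ← Real.exp_add, ← Real.exp_add]
      congr 1
      rw [Nat.cast_sub (hle n), Nat.cast_add, Nat.cast_sub ((hlam_pos n).trans (hle n))]
      simp only [E]
      push_cast; ring
    rw [hexp, ← mul_assoc]
    gcongr
  · rintro p ⟨hp, hfr⟩
    refine hfr.mono fun n hn => ?_
    obtain ⟨d, hd, hpd, hnd⟩ := exists_coding_iterate hb hJ R n hp
    rw [hnd] at hn
    rw [hpd]
    exact mem_cover hb hJ (hlam_pos n) (hle n) hd hn.1 hn.2

end UpperBound

section LowerBound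

/-- The mass distribution principle, tested on sets of diameter at most `b ^ (-m)`. -/
lemma le_dimH_of_measure_le {X : Type*} [MetricSpace X] [MeasurableSpace X] [BorelSpace X]
    {ν : Measure X} {E : Set X} {s : ℝ≥0} (hs : 0 < s) {b C : ℝ} (hb : 1 < b) (hC : 0 < C)
    (h : ∀ (m : ℕ) (U : Set X), Metric.ediam U ≤ ENNReal.ofReal ((b ^ m)⁻¹) →
      ν U ≤ ENNReal.ofReal (C * ((b ^ m)⁻¹) ^ (s : ℝ)))
    (hE : ν E ≠ 0) : (s : ℝ≥0∞) ≤ dimH E := by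
  have hb0 : 0 < b := by linarith
  have hs' : (0 : ℝ) < s := by exact_mod_cast hs
  have hinv0 : 0 < b⁻¹ := by positivity
  have hinv1 : b⁻¹ < 1 := inv_lt_one_of_one_lt₀ hb
  set K : ℝ := C * b ^ (s : ℝ) with hK
  have hK0 : 0 < K := by positivity
  have hbound : ∀ U : Set X, Metric.ediam U ≤ 1 →
      ν U ≤ ENNReal.ofReal K * Metric.ediam U ^ (s : ℝ) := by
    intro U hU
    have hfin : Metric.ediam U ≠ ⊤ := (hU.trans_lt ENNReal.one_lt_top).ne
    rcases eq_or_ne (Metric.ediam U) 0 with h0 | h0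
    · rw [h0, ENNReal.zero_rpow_of_pos hs', mul_zero]
      have ht : Tendsto (fun m : ℕ => ENNReal.ofReal (C * ((b ^ m)⁻¹) ^ (s : ℝ))) atTop (𝓝 0) := by
        have h1 : Tendsto (fun m : ℕ => (b ^ m)⁻¹) atTop (𝓝 0) := by
          simpa only [inv_pow] using tendsto_pow_atTop_nhds_zero_of_lt_one hinv0.le hinv1
        have h2 := (h1.rpow_const (p := (s : ℝ)) (Or.inr hs'.le)).const_mul C
        rw [Real.zero_rpow hs'.ne', mul_zero] at h2
        rw [← ENNReal.ofReal_zero]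
        exact (ENNReal.continuous_ofReal.tendsto 0).comp h2
      exact ge_of_tendsto' ht fun m => h m U (by simp [h0])
    · set δ := (Metric.ediam U).toReal
      have hδ : Metric.ediam U = ENNReal.ofReal δ := (ENNReal.ofReal_toReal hfin).symm
      have hδ0 : 0 < δ := ENNReal.toReal_pos h0 hfin
      have hδ1 : δ ≤ 1 := by
        rw [hδ] at hU
        exact ENNReal.ofReal_le_one.mp hU
      obtain ⟨m, hm1, hm2⟩ := exists_nat_pow_near_of_lt_one hδ0 hδ1 hinv0 hinv1
      rw [inv_pow] at hm2
      refine (h m U (by rw [hδ]; exact ENNReal.ofReal_le_ofReal hm2)).trans ?_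
      rw [hδ, ENNReal.ofReal_rpow_of_nonneg hδ0.le hs'.le, ← ENNReal.ofReal_mul hK0.le]
      refine ENNReal.ofReal_le_ofReal ?_
      have h3 : (b ^ m)⁻¹ ≤ b * δ := by
        rw [pow_succ, inv_pow] at hm1
        calc (b ^ m)⁻¹ = b * ((b ^ m)⁻¹ * b⁻¹) := by field_simp
          _ ≤ b * δ := by gcongr
      calc C * ((b ^ m)⁻¹) ^ (s : ℝ) ≤ C * (b * δ) ^ (s : ℝ) := by gcongr
        _ = K * δ ^ (s : ℝ) := by rw [Real.mul_rpow hb0.le hδ0.le, hK]; ring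
  have hKpos : ENNReal.ofReal K ≠ 0 := by simpa using hK0
  have hle : (ENNReal.ofReal K)⁻¹ • ν ≤ μH[(s : ℝ)] := by
    refine Measure.le_hausdorffMeasure _ _ 1 one_pos fun U hU => ?_
    rw [Measure.smul_apply, smul_eq_mul]
    calc _ ≤ (ENNReal.ofReal K)⁻¹ * (ENNReal.ofReal K * Metric.ediam U ^ (s : ℝ)) := by
          gcongr; exact hbound U hU
      _ = _ := by rw [← mul_assoc, ENNReal.inv_mul_cancel hKpos ENNReal.ofReal_ne_top, one_mul]
  refine le_dimH_of_hausdorffMeasure_ne_zero fun h0 => hE ?_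
  have := hle E
  rw [h0, Measure.smul_apply, smul_eq_mul, nonpos_iff_eq_zero, mul_eq_zero] at this
  exact this.resolve_left (ENNReal.inv_ne_zero.mpr ENNReal.ofReal_ne_top)

lemma measurable_point (b : ℕ) : Measurable (point b) := by
  have h : ∀ f : ℕ × ℕ → ℕ, Measurable fun d : ℕ → ℕ × ℕ => val b fun i => f (d i) := by
    intro f
    refine Measurable.tsum fun i => ?_
    have : Measurable fun a : ℕ × ℕ => (f a : ℝ) / (b : ℝ) ^ (i + 1) := measurable_of_countable _
    exact this.comp (measurable_pi_apply (i + 1))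
  exact (h Prod.fst).prodMk (h Prod.snd)

/-- A homogeneous digit-restricted set whose `m`-th generation has at least `b ^ (s * m)` cylinders
for all `m` has Hausdorff dimension at least `s`. -/
lemma le_dimH_of_card_le {b : ℕ} (hb : 2 ≤ b) {A : ℕ → Finset (ℕ × ℕ)} (hne : ∀ i, (A i).Nonempty)
    (hA : ∀ i, A i ⊆ Finset.range b ×ˢ Finset.range b) {s : ℝ≥0} (hs : 0 < s)
    (hcard : ∀ m : ℕ, ((b : ℝ) ^ m) ^ (s : ℝ) ≤ ∏ i ∈ Finset.Icc 1 m, ((A i).card : ℝ))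
    {E : Set (ℝ × ℝ)} (hE : ∀ d : ℕ → ℕ × ℕ, (∀ i, 1 ≤ i → d i ∈ A i) → point b d ∈ E) :
    (s : ℝ≥0∞) ≤ dimH E := by
  have hb1 : (1 : ℝ) < b := by exact_mod_cast hb
  have hb0 : (0 : ℝ) < b := by linarith
  let μ : ℕ → Measure (ℕ × ℕ) := fun i => (PMF.uniformOfFinset (A i) (hne i)).toMeasure
  have hμ : ∀ i a, μ i {a} ≤ ((A i).card : ℝ≥0∞)⁻¹ := by
    intro i a
    simp only [μ]
    rw [PMF.toMeasure_apply_singleton _ _ (measurableSet_singleton a), PMF.uniformOfFinset_apply]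
    split_ifs <;> simp
  let P := Measure.infinitePi μ
  have hae : ∀ᵐ d ∂P, ∀ i, d i ∈ A i := by
    rw [ae_all_iff]
    intro i
    have h1 : ∀ᵐ a ∂(μ i), a ∈ A i := by
      rw [ae_iff, PMF.toMeasure_apply_eq_zero_iff _ (Set.to_countable _).measurableSet,
        PMF.support_uniformOfFinset, Set.disjoint_left]
      intro a ha ha'
      exact ha' (by simpa using ha)
    rw [← Measure.infinitePi_map_eval μ i] at h1
    exact ae_of_ae_map (measurable_pi_apply i).aemeasurable h1
  have hdig : ∀ d : ℕ → ℕ × ℕ, (∀ i, d i ∈ A i) → (∀ i, 1 ≤ i → (d i).1 < b) ∧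
      ∀ i, 1 ≤ i → (d i).2 < b := by
    intro d hd
    have := fun i => Finset.mem_product.mp (hA i (hd i))
    exact ⟨fun i _ => by simpa using (this i).1, fun i _ => by simpa using (this i).2⟩
  have hcyl : ∀ (m X Y : ℕ), P {d | (∀ i, d i ∈ A i) ∧ pre b (fun i => (d i).1) m = X ∧
      pre b (fun i => (d i).2) m = Y} ≤ ENNReal.ofReal ((((b : ℝ) ^ m)⁻¹) ^ (s : ℝ)) := by
    intro m X Y
    rcases Set.eq_empty_or_nonempty {d : ℕ → ℕ × ℕ | (∀ i, d i ∈ A i) ∧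
      pre b (fun i => (d i).1) m = X ∧ pre b (fun i => (d i).2) m = Y} with h0 | ⟨w, hw, hwX, hwY⟩
    · rw [h0]; simp
    have hsub : {d : ℕ → ℕ × ℕ | (∀ i, d i ∈ A i) ∧ pre b (fun i => (d i).1) m = X ∧
        pre b (fun i => (d i).2) m = Y} ⊆ Set.pi (Finset.Icc 1 m) fun i => {w i} := by
      rintro d ⟨hd, hdX, hdY⟩ i hi
      have hi' := Finset.mem_Icc.mp hi
      exact Prod.ext
        (digits_eq_of_pre_eq (hdig d hd).1 (hdig w hw).1 (hdX.trans hwX.symm) i hi'.1 hi'.2)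
        (digits_eq_of_pre_eq (hdig d hd).2 (hdig w hw).2 (hdY.trans hwY.symm) i hi'.1 hi'.2)
    refine (measure_mono hsub).trans ?_
    simp only [P]
    rw [Measure.infinitePi_pi μ fun i _ => measurableSet_singleton (w i)]
    have hpos : ∀ i, (0 : ℝ) < (A i).card := fun i => by exact_mod_cast (hne i).card_pos
    calc ∏ i ∈ Finset.Icc 1 m, μ i {w i}
        ≤ ∏ i ∈ Finset.Icc 1 m, ENNReal.ofReal (((A i).card : ℝ)⁻¹) := by
          refine Finset.prod_le_prod' fun i _ => (hμ i _).trans ?_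
          rw [ENNReal.ofReal_inv_of_pos (hpos i), ENNReal.ofReal_natCast]
      _ = ENNReal.ofReal ((∏ i ∈ Finset.Icc 1 m, ((A i).card : ℝ))⁻¹) := by
          rw [← ENNReal.ofReal_prod_of_nonneg fun i _ => by positivity, Finset.prod_inv_distrib]
      _ ≤ _ := by
          refine ENNReal.ofReal_le_ofReal ?_
          rw [Real.inv_rpow (by positivity)]
          exact inv_anti₀ (by positivity) (hcard m)
  refine le_dimH_of_measure_le (ν := P.map (point b)) hs hb1 (C := 16) (by norm_num) ?_ ?_
  · intro m U hU
    rcases U.eq_empty_or_nonempty with rfl | ⟨p, hp⟩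
    · simp
    have hUsub : U ⊆ Metric.closedBall p (((b : ℝ) ^ m)⁻¹) := by
      intro q hq
      have := (Metric.edist_le_ediam_of_mem hq hp).trans hU
      rw [edist_dist] at this
      exact (ENNReal.ofReal_le_ofReal_iff (by positivity)).mp this
    refine (measure_mono hUsub).trans ?_
    rw [Measure.map_apply (measurable_point b) Metric.isClosed_closedBall.measurableSet]
    let IX : ℝ → Finset ℕ := fun z => Finset.Icc (⌊(b : ℝ) ^ m * z⌋₊ - 2) (⌊(b : ℝ) ^ m * z⌋₊ + 1)
    have hIX : ∀ z, (IX z).card ≤ 4 := fun z => by rw [Nat.card_Icc]; omega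
    have hle : P (point b ⁻¹' Metric.closedBall p (((b : ℝ) ^ m)⁻¹)) ≤
        P (⋃ q ∈ IX p.1 ×ˢ IX p.2, {d : ℕ → ℕ × ℕ | (∀ i, d i ∈ A i) ∧
          pre b (fun i => (d i).1) m = q.1 ∧ pre b (fun i => (d i).2) m = q.2}) := by
      refine measure_mono_ae ?_
      filter_upwards [hae] with d hd hdp
      have hdp' : dist (point b d) p ≤ ((b : ℝ) ^ m)⁻¹ := hdp
      rw [Prod.dist_eq, max_le_iff] at hdp'
      exact mem_iUnion₂.mpr ⟨(_, _), Finset.mem_product.mpr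
        ⟨pre_mem_Icc hb (hdig d hd).1 hdp'.1, pre_mem_Icc hb (hdig d hd).2 hdp'.2⟩, hd, rfl, rfl⟩
    refine hle.trans ((measure_biUnion_finset_le _ _).trans ?_)
    refine (Finset.sum_le_sum fun q _ => hcyl m q.1 q.2).trans ?_
    rw [Finset.sum_const, Finset.card_product, nsmul_eq_mul, ENNReal.ofReal_mul (by norm_num)]
    gcongr
    have : (IX p.1).card * (IX p.2).card ≤ 4 * 4 := Nat.mul_le_mul (hIX _) (hIX _)
    calc (((IX p.1).card * (IX p.2).card : ℕ) : ℝ≥0∞) ≤ ((4 * 4 : ℕ) : ℝ≥0∞) := by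
          exact_mod_cast this
      _ = ENNReal.ofReal 16 := by norm_num
  · intro h0
    have h1 := Measure.le_map_apply (measurable_point b).aemeasurable (μ := P) E
    rw [h0, nonpos_iff_eq_zero] at h1
    have h2 : P (point b ⁻¹' E)ᶜ = 0 :=
      ae_iff.mp (hae.mono fun d hd => hE d fun i _ => hd i)
    have h3 := measure_union_le (μ := P) (point b ⁻¹' E) (point b ⁻¹' E)ᶜ
    rw [Set.union_compl_self, measure_univ, h1, h2] at h3
    simp at h3

end LowerBound

section Construction

lemma add_mul_le_sum_Icc {f : ℕ → ℝ} {a m : ℕ} {C : ℝ} (ham : a ≤ m)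
    (h : ∀ i, a < i → i ≤ m → C ≤ f i) :
    ∑ i ∈ Finset.Icc 1 a, f i + (m - a) * C ≤ ∑ i ∈ Finset.Icc 1 m, f i := by
  induction m, ham using Nat.le_induction with
  | base => simp
  | succ m ham ih =>
    rw [Finset.sum_Icc_succ_top (by omega)]
    have h1 := ih fun i h1 h2 => h i h1 (by omega)
    have h2 := h (m + 1) (by omega) le_rfl
    push_cast
    linarith

lemma eventually_nonneg_of_tendsto_div {E : ℕ → ℝ} {e : ℝ} (he : 0 < e)
    (hE : Tendsto (fun n => E n / n) atTop (𝓝 e)) : ∀ᶠ n in atTop, 0 ≤ E n := by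
  filter_upwards [hE.eventually_const_lt he, eventually_gt_atTop 0] with n hn hn0
  have : (0 : ℝ) < n := by exact_mod_cast hn0
  exact ((div_pos_iff_of_pos_right this).mp hn).le

lemma exists_enumerating_word {α : Type*} {J : Finset α} (hJ : J.Nonempty) :
    ∃ w : ℕ → α, (∀ i, w i ∈ J) ∧ ∀ a ∈ J, ∃ i, 1 ≤ i ∧ i ≤ J.card ∧ w i = a := by
  obtain ⟨a₀, ha₀⟩ := hJ
  refine ⟨fun i => if h : i - 1 < J.card then (J.equivFin.symm ⟨i - 1, h⟩ : α) else a₀,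
    fun i => ?_, fun a ha => ?_⟩
  · dsimp only
    split_ifs
    · exact Subtype.property _
    · exact ha₀
  · refine ⟨J.equivFin ⟨a, ha⟩ + 1, by omega, (J.equivFin ⟨a, ha⟩).isLt, ?_⟩
    simp

/-- The digits allowed at position `i` in a block starting after position `n`: first the digits of
`c`, up to length `L`, then free digits in row `0`, up to length `M`, then the word `w`. -/
def blockDigits (J : Finset (ℕ × ℕ)) (c w : ℕ → ℕ × ℕ) (L M n i : ℕ) : Finset (ℕ × ℕ) :=
  if i ≤ n + L then {c (i - n)} else if i ≤ n + M then J2 J 0 else {w (i - (n + M))}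

lemma blockDigits_subset {J : Finset (ℕ × ℕ)} {c w : ℕ → ℕ × ℕ}
    (hc : ∀ i, 1 ≤ i → c i ∈ J2 J 0) (hw : ∀ i, w i ∈ J) {L M n i : ℕ} (hi : n < i) :
    blockDigits J c w L M n i ⊆ J := by
  unfold blockDigits
  split_ifs
  · exact Finset.singleton_subset_iff.mpr (Finset.filter_subset _ _ (hc _ (by omega)))
  · exact Finset.filter_subset _ _
  · exact Finset.singleton_subset_iff.mpr (hw _)

lemma blockDigits_nonempty {J : Finset (ℕ × ℕ)} {c w : ℕ → ℕ × ℕ}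
    (hc : ∀ i, 1 ≤ i → c i ∈ J2 J 0) {L M n i : ℕ} : (blockDigits J c w L M n i).Nonempty := by
  unfold blockDigits
  split_ifs
  · exact Finset.singleton_nonempty _
  · exact ⟨_, hc 1 le_rfl⟩
  · exact Finset.singleton_nonempty _

set_option maxHeartbeats 1000000 in
/-- Homogeneous digit restrictions, with many words of every length, forcing the orbit to hit the
targets infinitely often and every digit of `J` to appear infinitely often. -/
lemma exists_digit_sets {J : Finset (ℕ × ℕ)} {c : ℕ → ℕ × ℕ} (hc : ∀ i, 1 ≤ i → c i ∈ J2 J 0)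
    {lam xi : ℕ → ℕ} (hle : ∀ n, lam n ≤ xi n) {l x : ℝ}
    (hl : Tendsto (fun n : ℕ => (lam n : ℝ) / n) atTop (𝓝 l))
    (hx : Tendsto (fun n : ℕ => (xi n : ℝ) / n) atTop (𝓝 x)) {σ : ℝ} (hσ : 0 ≤ σ)
    (h1 : σ * (1 + l) < Real.log J.card)
    (h2 : σ * (1 + x) < Real.log J.card + (x - l) * Real.log (J2 J 0).card) :
    ∃ A : ℕ → Finset (ℕ × ℕ), (∀ i, (A i).Nonempty) ∧ (∀ i, A i ⊆ J) ∧
      (∀ m : ℕ, σ * m ≤ ∑ i ∈ Finset.Icc 1 m, Real.log (A i).card) ∧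
      ∀ d : ℕ → ℕ × ℕ, (∀ i, 1 ≤ i → d i ∈ A i) → (∀ a ∈ J, ∃ᶠ i in atTop, d i = a) ∧
        ∃ᶠ n in atTop, (∀ i, 1 ≤ i → i ≤ lam n → d (i + n) = c i) ∧
          ∀ i, 1 ≤ i → i ≤ xi n → (d (i + n)).2 = 0 := by
  classical
  have hJne : J.Nonempty := ⟨c 1, Finset.filter_subset _ _ (hc 1 le_rfl)⟩
  obtain ⟨w, hwJ, hw⟩ := exists_enumerating_word hJne
  have hl0 : 0 ≤ l := ge_of_tendsto' hl fun n => by positivity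
  set D := Real.log J.card with hD
  set D0 := Real.log (J2 J 0).card with hD0
  have hD0' : 0 ≤ D0 := Real.log_natCast_nonneg _
  have hσD : σ ≤ D := by nlinarith
  have hgood : ∀ K : ℕ, ∃ n : ℕ, K ≤ n ∧ 0 ≤ (n - K) * D - σ * (n + lam n) ∧
      0 ≤ (n - K) * D + (xi n - lam n : ℝ) * D0 - σ * (n + xi n + J.card) := by
    intro K
    have hzero : ∀ a : ℝ, Tendsto (fun n : ℕ => a / (n : ℝ)) atTop (𝓝 0) := fun a =>
      tendsto_const_nhds.div_atTop tendsto_natCast_atTop_atTop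
    have e1 : Tendsto (fun n : ℕ => ((n - K) * D - σ * (n + lam n)) / (n : ℝ)) atTop
        (𝓝 ((1 - 0) * D - σ * (1 + l))) := by
      refine ((((hzero K).const_sub 1).mul_const D).sub ((hl.const_add 1).const_mul σ)).congr' ?_
      filter_upwards [eventually_gt_atTop 0] with n hn
      have : (n : ℝ) ≠ 0 := by positivity
      field_simp
    have e2 : Tendsto (fun n : ℕ => ((n - K) * D + (xi n - lam n : ℝ) * D0 -
        σ * (n + xi n + J.card)) / (n : ℝ)) atTop
        (𝓝 ((1 - 0) * D + (x - l) * D0 - σ * (1 + x + 0))) := by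
      refine (((((hzero K).const_sub 1).mul_const D).add ((hx.sub hl).mul_const D0)).sub
        (((hx.const_add 1).add (hzero J.card)).const_mul σ)).congr' ?_
      filter_upwards [eventually_gt_atTop 0] with n hn
      have : (n : ℝ) ≠ 0 := by positivity
      field_simp
    obtain ⟨n, ⟨hn1, hn2⟩, hn3⟩ := (((eventually_nonneg_of_tendsto_div (by linarith) e1).and
      (eventually_nonneg_of_tendsto_div (by linarith) e2)).and (eventually_ge_atTop K)).exists
    exact ⟨n, hn3, hn1, hn2⟩
  choose N hNK hN1 hN2 using hgood
  obtain ⟨K, hK0, hKs⟩ : ∃ K : ℕ → ℕ, K 0 = 0 ∧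
      ∀ k, K (k + 1) = N (K k) + xi (N (K k)) + J.card :=
    ⟨fun k => Nat.rec 0 (fun _ K => N K + xi (N K) + J.card) k, rfl, fun _ => rfl⟩
  have hJpos : 0 < J.card := hJne.card_pos
  have hKlt : ∀ k, K k < K (k + 1) := fun k => by
    have := hNK (K k)
    rw [hKs]; omega
  have hKmono : StrictMono K := strictMono_nat_of_lt_succ hKlt
  have hKid : ∀ k, k ≤ K k := hKmono.id_le
  let B : ℕ → ℕ → Finset (ℕ × ℕ) := fun n i => blockDigits J c w (lam n) (xi n) n i
  let A : ℕ → Finset (ℕ × ℕ) := fun i =>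
    J.filter fun e => ∀ k, N (K k) < i → i ≤ K (k + 1) → e ∈ B (N (K k)) i
  have hAJ : ∀ i, A i ⊆ J := fun i => Finset.filter_subset _ _
  have huniq : ∀ {i k k'}, K k < i → i ≤ K (k + 1) → K k' < i → i ≤ K (k' + 1) → k = k' := by
    intro i k k' ha hb hc hd
    by_contra hne
    rcases Nat.lt_or_gt_of_ne hne with h | h
    · have := hKmono.monotone (show k + 1 ≤ k' from h); omega
    · have := hKmono.monotone (show k' + 1 ≤ k from h); omega
  have hAfree : ∀ k i, K k < i → i ≤ N (K k) → A i = J := by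
    intro k i h1 h2
    refine Finset.filter_true_of_mem fun e _ k' h3 h4 => ?_
    have hlt : N (K k) ≤ K (k + 1) := by rw [hKs]; omega
    have hk := huniq h1 (h2.trans hlt) ((hNK (K k')).trans_lt h3) h4
    subst hk
    omega
  have hAblock : ∀ k i, N (K k) < i → i ≤ K (k + 1) → A i = B (N (K k)) i := by
    intro k i h1 h2
    ext e
    simp only [A, Finset.mem_filter]
    constructor
    · exact fun h => h.2 k h1 h2
    · intro h
      refine ⟨blockDigits_subset hc hwJ h1 h, fun k' h3 h4 => ?_⟩
      have hk := huniq ((hNK (K k)).trans_lt h1) h2 ((hNK (K k')).trans_lt h3) h4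
      exact hk ▸ h
  have hAne : ∀ i, (A i).Nonempty := by
    intro i
    by_cases h : ∃ k, N (K k) < i ∧ i ≤ K (k + 1)
    · obtain ⟨k, h1, h2⟩ := h
      rw [hAblock k i h1 h2]
      exact blockDigits_nonempty hc
    · push Not at h
      rw [show A i = J from Finset.filter_true_of_mem fun e _ k h3 h4 => absurd h4 (h k h3).not_ge]
      exact hJne
  set S : ℕ → ℝ := fun m => ∑ i ∈ Finset.Icc 1 m, Real.log (A i).card with hS
  have hlog0 : ∀ i, 0 ≤ Real.log (A i).card := fun i => Real.log_natCast_nonneg _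
  have hSmono : ∀ {a m}, a ≤ m → S a ≤ S m := fun {a m} ham => by
    have := add_mul_le_sum_Icc ham (f := fun i => Real.log (A i).card) (C := 0)
      fun i _ _ => hlog0 i
    simpa using this
  have hSbound : ∀ k m, m ≤ K k → σ * m ≤ S m := by
    intro k
    induction k with
    | zero =>
      intro m hm
      have : m = 0 := by simpa [hK0] using hm
      simp [this, hS]
    | succ k ih =>
      intro m hm
      rcases le_or_gt m (K k) with hmk | hmk
      · exact ih m hmk
      have hfree : ∀ m : ℕ, K k ≤ m → m ≤ N (K k) → S (K k) + ((m : ℝ) - K k) * D ≤ S m := by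
        intro m h1 h2
        refine add_mul_le_sum_Icc h1 fun i h3 h4 => ?_
        rw [hAfree k i h3 (h4.trans h2)]
      rcases le_or_gt m (N (K k)) with hmn | hmn
      · have h3 := hfree m hmk.le hmn
        have h4 := ih (K k) le_rfl
        have h5 : (K k : ℝ) ≤ m := by exact_mod_cast hmk.le
        linarith [mul_le_mul_of_nonneg_left hσD (sub_nonneg.mpr h5)]
      set n := N (K k) with hn
      have hSn : ((n : ℝ) - K k) * D ≤ S n := by
        have h3 := hfree n (hNK (K k)) le_rfl
        have h4 : 0 ≤ S (K k) := Finset.sum_nonneg fun i _ => hlog0 i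
        linarith
      have g1 : 0 ≤ ((n : ℝ) - K k) * D - σ * (n + lam n) := hN1 (K k)
      have g2 : 0 ≤ ((n : ℝ) - K k) * D + (xi n - lam n : ℝ) * D0 - σ * (n + xi n + J.card) :=
        hN2 (K k)
      have hlx := hle n
      have hAn : ∀ i, n < i → i ≤ n + xi n + J.card → A i = B n i := fun i h3 h4 =>
        hAblock k i h3 (by rw [hKs]; exact h4)
      have hmn' : m ≤ n + xi n + J.card := by rwa [hKs] at hm
      clear_value n
      have hmid : ∀ m : ℕ, n + lam n ≤ m → m ≤ n + xi n → S n + (m - (n + lam n)) * D0 ≤ S m := by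
        intro m h3 h4
        have h5 := add_mul_le_sum_Icc h3 (f := fun i => Real.log (A i).card) (C := D0)
          fun i h6 h7 => by
            rw [hAn i (by omega) (by omega)]
            simp only [B, blockDigits]
            rw [if_neg (by omega), if_pos (by omega)]
        have h6 := hSmono (show n ≤ n + lam n by omega)
        push_cast at h5
        linarith
      rcases le_or_gt m (n + lam n) with h3 | h3
      · have h4 := hSmono hmn.le
        have h5 : (m : ℝ) ≤ n + lam n := by exact_mod_cast h3
        linarith [mul_le_mul_of_nonneg_left h5 hσ]
      rcases le_or_gt m (n + xi n) with h4 | h4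
      · have h5 := hmid m h3.le h4
        have h6 : (n : ℝ) + lam n ≤ m := by exact_mod_cast h3.le
        have h7 : (m : ℝ) ≤ n + xi n := by exact_mod_cast h4
        rcases le_total σ D0 with h8 | h8
        · linarith [mul_le_mul_of_nonneg_left h8 (sub_nonneg.mpr h6)]
        · have h9 := mul_le_mul_of_nonneg_left h8 (sub_nonneg.mpr h7)
          have h10 : 0 ≤ σ * (J.card : ℝ) := by positivity
          linarith
      · have h5 := hmid (n + xi n) (by omega) le_rfl
        have h6 := hSmono h4.le
        have h7 : (m : ℝ) ≤ n + xi n + J.card := by exact_mod_cast hmn'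
        push_cast at h5
        linarith [mul_le_mul_of_nonneg_left h7 hσ]
  refine ⟨A, hAne, hAJ, fun m => hSbound m m (hKid m), fun d hd => ?_⟩
  have hdB : ∀ k i, N (K k) < i → i ≤ K (k + 1) → d i ∈ B (N (K k)) i := fun k i h3 h4 => by
    rw [← hAblock k i h3 h4]; exact hd i (by omega)
  constructor
  · intro a ha
    obtain ⟨j, hj1, hj2, hja⟩ := hw a ha
    refine frequently_atTop.mpr fun k => ?_
    have hk := (hKid k).trans (hNK (K k))
    have hlx := hle (N (K k))
    refine ⟨N (K k) + xi (N (K k)) + j, by omega, ?_⟩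
    have h3 := hdB k (N (K k) + xi (N (K k)) + j) (by omega) (by rw [hKs]; omega)
    simp only [B, blockDigits] at h3
    rw [if_neg (by omega), if_neg (by omega), Finset.mem_singleton, Nat.add_sub_cancel_left] at h3
    rw [h3, hja]
  · refine frequently_atTop.mpr fun k => ⟨N (K k), (hKid k).trans (hNK (K k)), ?_⟩
    have hlx := hle (N (K k))
    have hfix : ∀ i, 1 ≤ i → i ≤ lam (N (K k)) → d (i + N (K k)) = c i := by
      intro i hi hi'
      have h3 := hdB k (i + N (K k)) (by omega) (by rw [hKs]; omega)
      simp only [B, blockDigits] at h3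
      rwa [if_pos (by omega), Finset.mem_singleton, Nat.add_sub_cancel] at h3
    refine ⟨hfix, fun i hi hi' => ?_⟩
    rcases le_or_gt i (lam (N (K k))) with h4 | h4
    · rw [hfix i hi h4]
      exact (Finset.mem_filter.mp (hc i hi)).2
    · have h3 := hdB k (i + N (K k)) (by omega) (by rw [hKs]; omega)
      simp only [B, blockDigits] at h3
      rw [if_neg (by omega), if_pos (by omega)] at h3
      exact (Finset.mem_filter.mp h3).2

lemma le_dimH_targetSet {b : ℕ} {J : Finset (ℕ × ℕ)} (hb : 2 ≤ b)
    (hJ : J ⊆ Finset.range b ×ˢ Finset.range b) (R : RepMap b J) {c : ℕ → ℕ × ℕ}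
    (hc : ∀ i, 1 ≤ i → c i ∈ J2 J 0) {lam xi : ℕ → ℕ} (hle : ∀ n, lam n ≤ xi n) {l x : ℝ}
    (hl : Tendsto (fun n : ℕ => (lam n : ℝ) / n) atTop (𝓝 l))
    (hx : Tendsto (fun n : ℕ => (xi n : ℝ) / n) atTop (𝓝 x)) {s : ℝ≥0} (hs : 0 < s)
    (h1 : (s : ℝ) < (Real.log J.card / Real.log b) / (1 + l))
    (h2 : (s : ℝ) < (Real.log J.card / Real.log b +
      (x - l) * (Real.log (J2 J 0).card / Real.log b)) / (1 + x)) :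
    (s : ℝ≥0∞) ≤ dimH (targetSet R lam xi (point b c).1 0) := by
  have hb1 : (1 : ℝ) < b := by exact_mod_cast hb
  have hb0 : (0 : ℝ) < b := by linarith
  have hlb : 0 < Real.log b := Real.log_pos hb1
  have hl0 : 0 ≤ l := ge_of_tendsto' hl fun n => by positivity
  have hx0 : 0 ≤ x := ge_of_tendsto' hx fun n => by positivity
  have hcJ : ∀ i, 1 ≤ i → c i ∈ J := fun i hi => Finset.filter_subset _ _ (hc i hi)
  obtain ⟨A, hAne, hAJ, hAcard, hAd⟩ := exists_digit_sets hc hle hl hx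
    (σ := s * Real.log b) (by positivity)
    (by
      rw [lt_div_iff₀ (by linarith), lt_div_iff₀ hlb] at h1
      linarith)
    (by
      rw [lt_div_iff₀ (by linarith), ← mul_div_assoc, ← add_div, lt_div_iff₀ hlb] at h2
      linarith)
  refine le_dimH_of_card_le hb hAne (fun i => (hAJ i).trans hJ) hs (fun m => ?_) fun d hd => ?_
  · have hpos : ∀ i, (0 : ℝ) < (A i).card := fun i => by exact_mod_cast (hAne i).card_pos
    have hprod : 0 < ∏ i ∈ Finset.Icc 1 m, ((A i).card : ℝ) :=
      Finset.prod_pos fun i _ => hpos i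
    rw [← Real.log_le_log_iff (by positivity) hprod, Real.log_rpow (by positivity), Real.log_pow,
      Real.log_prod fun i _ => (hpos i).ne']
    linarith [hAcard m]
  · obtain ⟨hfr, hhit⟩ := hAd d hd
    have hdJ : ∀ i, 1 ≤ i → d i ∈ J := fun i hi => hAJ i (hd i hi)
    refine ⟨⟨d, hdJ, rfl⟩, hhit.mono fun n hn => ?_⟩
    rw [iterate_Tmap_of_frequently hb hJ R hdJ hfr n]
    exact point_mem_target hb hJ (shift_mem hdJ n) hcJ hn.1 hn.2

end Construction

theorem stmt_14
    (b : ℕ) (J : Finset (ℕ × ℕ)) (hb : 2 ≤ b)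
    (hJ : J ⊂ Finset.range b ×ˢ Finset.range b) (hJcard : 2 ≤ J.card)
    (R : RepMap b J) (lam xi : ℕ → ℕ)
    (hlam_pos : ∀ n, 1 ≤ lam n) (hle : ∀ n, lam n ≤ xi n)
    (hlam_top : Tendsto lam atTop atTop)
    (l x : ℝ)
    (hl : Tendsto (fun n : ℕ => (lam n : ℝ) / n) atTop (𝓝 l))
    (hx : Tendsto (fun n : ℕ => (xi n : ℝ) / n) atTop (𝓝 x))
    (hlx : l < x)
    (z : ℝ) (hz : z ∈ Icc (0 : ℝ) 1) (hzw : ((z : ℝ), (0 : ℝ)) ∈ carpet b J) :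
    dimH (targetSet R lam xi z 0) =
      ENNReal.ofReal (min ((Real.log J.card / Real.log b) / (1 + l))
        (((Real.log J.card / Real.log b) + (x - l) * (Real.log ((J2 J 0).card) / Real.log b)) / (1 + x))) := by
  have hJs := hJ.subset
  have hb1 : (1 : ℝ) < b := by exact_mod_cast hb
  obtain ⟨c, hcJ, hcz⟩ := hzw
  have hc0 := digits_eq_zero_of_val_eq_zero hb (snd_lt hJs hcJ) (congrArg Prod.snd hcz).symm
  have hc : ∀ i, 1 ≤ i → c i ∈ J2 J 0 := fun i hi => Finset.mem_filter.mpr ⟨hcJ i hi, hc0 i hi⟩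
  have hzc : z = (point b c).1 := congrArg Prod.fst hcz
  have hJ2 : 0 < (J2 J 0).card := Finset.card_pos.mpr ⟨_, hc 1 le_rfl⟩
  refine le_antisymm ?_ ?_
  · rw [ENNReal.ofReal_min]
    refine le_min ?_ (dimH_targetSet_le hb hJs (by omega) hJ2 R hlam_pos hle hl hx z)
    have h := dimH_targetSet_le hb hJs (by omega) hJ2 R hlam_pos (fun n => le_rfl) hl hl z
    rw [sub_self, zero_mul, add_zero] at h
    refine (dimH_mono ?_).trans h
    rintro p ⟨hp, hfr⟩
    refine ⟨hp, hfr.mono fun n hn => ⟨hn.1, ?_⟩⟩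
    have hpow : (b : ℝ) ^ (-(xi n : ℤ)) ≤ (b : ℝ) ^ (-(lam n : ℤ)) :=
      zpow_le_zpow_right₀ hb1.le (by have := hle n; omega)
    exact Icc_subset_Icc (by linarith) (by linarith) hn.2
  · refine ENNReal.le_of_forall_nnreal_lt fun s hs => ?_
    rcases eq_or_ne s 0 with rfl | hs0
    · simp
    rw [← ENNReal.ofReal_coe_nnreal] at hs
    have hs' := ENNReal.ofReal_lt_ofReal_iff'.mp hs
    rw [hzc]
    exact le_dimH_targetSet hb hJs R hc hle hl hx (pos_iff_ne_zero.mpr hs0)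
      (lt_min_iff.mp hs'.1).1 (lt_min_iff.mp hs'.1).2

end ShrinkingRect
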